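/- arXiv:2511.21277 — 4 statements merged into one kernel-verified Lean document; each statement's English description precedes it below -/
import Mathlib

section
/- Let T ≥ 2 and SR_P ≥ 1 be integers, let SR_O and d be natural numbers with d + 1 ≤ T − 1, and let n = gcd(SR_P, T). Then the set A* = { x ∈ {0, …, T−1} : d + 1 ≤ (SR_O + x·SR_P) mod T ≤ T − 1 } (i.e., the largest set of residues x modulo T whose associated slot SR_O + x·SR_P falls, modulo T, in an uplink slot {d+1, …, T−1}) is equal to the explicit set { ( (j · (SR_P/n)^{φ(T/n) − 1}) mod (T/n) ) + (T/n)·i : j ∈ D, i ∈ {0, …, n−1} }, where the inner mod takes the nonnegative representative in {0, …, T/n − 1}. -/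
/-- Euler's theorem over `ℤ`: for `p` coprime to `m > 0`, the power `p ^ (φ(m) - 1)` is an
inverse of `p` modulo `m`. -/
theorem Int.dvd_mul_pow_totient_sub_one_sub_one {p m : ℤ} (hm : 0 < m) (h : IsCoprime p m) :
    m ∣ p * p ^ (Nat.totient m.toNat - 1) - 1 := by
  lift m to ℕ using hm.le
  have hφ : 0 < Nat.totient m := Nat.totient_pos.2 (by exact_mod_cast hm)
  rw [Int.toNat_natCast, ← pow_succ', Nat.sub_add_cancel hφ,
    ← ZMod.intCast_zmod_eq_zero_iff_dvd]
  have hu : IsUnit (p : ZMod m) := (ZMod.coe_int_isUnit_iff_isCoprime p m).2 h.symm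
  obtain ⟨u, hu⟩ := hu
  have := congrArg (Units.val) (ZMod.pow_totient u)
  push_cast at this ⊢
  rw [← hu, this, sub_self]


/-- **Lemma 1 of the paper.** Let `T ≥ 2`, `SR_P ≥ 1`, `SR_O d : ℕ` with `d + 1 ≤ T - 1`,
and `n = gcd(SR_P, T)`.  The set of scheduling-request indices `x ∈ {0, …, T-1}` whose
associated slot `SR_O + x·SR_P` falls, modulo `T`, in an uplink slot `{d+1, …, T-1}`
equals the explicit set
`{ ((j · (SR_P/n)^{φ(T/n) - 1}) mod (T/n)) + (T/n)·i : j ∈ D, i ∈ {0, …, n-1} }`,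
where `D` is the integer interval `[⌈(d+1-SR_O)/n⌉, ⌊(T-1-SR_O)/n⌋]`. -/
theorem stmt0 (T SR_P : ℤ) (SR_O d : ℕ)
    (hT : 2 ≤ T) (hP : 1 ≤ SR_P) (hd : (d : ℤ) + 1 ≤ T - 1)
    (n : ℤ) (hn : n = Int.gcd SR_P T) :
    {x : ℤ | 0 ≤ x ∧ x ≤ T - 1 ∧
        (d : ℤ) + 1 ≤ ((SR_O : ℤ) + x * SR_P) % T ∧
        ((SR_O : ℤ) + x * SR_P) % T ≤ T - 1} =
    {z : ℤ | ∃ j i : ℤ,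
        ⌈(((d : ℤ) + 1 - (SR_O : ℤ) : ℤ) : ℚ) / (n : ℚ)⌉ ≤ j ∧
        j ≤ ⌊(((T : ℤ) - 1 - (SR_O : ℤ) : ℤ) : ℚ) / (n : ℚ)⌋ ∧
        0 ≤ i ∧ i ≤ n - 1 ∧
        z = (j * (SR_P / n) ^ (Nat.totient (T / n).toNat - 1)) % (T / n) + (T / n) * i} := by
  have hn0 : 0 < n := by
    rw [hn]
    exact_mod_cast Int.gcd_pos_of_ne_zero_left T (by omega)
  obtain ⟨p, hp⟩ : n ∣ SR_P := hn ▸ Int.gcd_dvd_left SR_P T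
  obtain ⟨m, hm⟩ : n ∣ T := hn ▸ Int.gcd_dvd_right SR_P T
  have hcop : IsCoprime p m := by
    have hg : n = n * Int.gcd p m := by
      conv_lhs => rw [hn, hp, hm, Int.gcd_mul_left]
      push_cast
      rw [abs_of_pos hn0]
    rw [Int.isCoprime_iff_gcd_eq_one]
    have : (Int.gcd p m : ℤ) = 1 := mul_left_cancel₀ hn0.ne' (by linarith)
    exact_mod_cast this
  have hm0 : 0 < m := by
    by_contra! h
    nlinarith
  have hPn : SR_P / n = p := by rw [hp, Int.mul_ediv_cancel_left _ hn0.ne']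
  have hTn : T / n = m := by rw [hm, Int.mul_ediv_cancel_left _ hn0.ne']
  have hnQ : (0 : ℚ) < n := by exact_mod_cast hn0
  rw [hPn, hTn]
  obtain ⟨k, hk⟩ := Int.dvd_mul_pow_totient_sub_one_sub_one hm0 hcop
  generalize p ^ (Nat.totient m.toNat - 1) = c at hk ⊢
  clear hn hPn hTn hcop
  ext x
  simp only [Set.mem_ofPred_eq, Int.ceil_le, Int.le_floor, div_le_iff₀ hnQ, le_div_iff₀ hnQ,
    ← Int.cast_mul, Int.cast_le]
  constructor
  · rintro ⟨hx0, hxT, hlo, hhi⟩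
    have hy := Int.emod_add_mul_ediv ((SR_O : ℤ) + x * SR_P) T
    set y := ((SR_O : ℤ) + x * SR_P) % T
    set q := ((SR_O : ℤ) + x * SR_P) / T
    have hj : (x * p - m * q) * n = y - SR_O := by
      rw [hp, hm] at hy
      linarith
    refine ⟨x * p - m * q, x / m, ?_, ?_, Int.ediv_nonneg hx0 hm0.le, ?_, ?_⟩
    · rw [hj]; linarith
    · rw [hj]; linarith
    · have : x / m < n := Int.ediv_lt_of_lt_mul hm0 (by linarith)
      omega
    · have : (x * p - m * q) * c = x + m * (x * k - q * c) := by linear_combination x * hk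
      rw [this, Int.add_mul_emod_self_left, Int.emod_add_mul_ediv]
  · rintro ⟨j, i, hlo, hhi, hi0, hin, rfl⟩
    have hr0 := Int.emod_nonneg (j * c) hm0.ne'
    have hrm := Int.emod_lt_of_pos (j * c) hm0
    have hr := Int.emod_add_mul_ediv (j * c) m
    set r := j * c % m
    set q := j * c / m
    have hslot : (SR_O : ℤ) + (r + m * i) * SR_P = (SR_O + j * n) + T * (j * k - q * p + i * p) := by
      rw [hp, hm]
      linear_combination n * p * hr + n * j * hk
    rw [hslot, Int.add_mul_emod_self_left, Int.emod_eq_of_lt (by omega) (by omega)]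
    refine ⟨by positivity, ?_, by linarith, by linarith⟩
    have : m * i ≤ m * (n - 1) := by gcongr
    linarith
end

section
/- Let T ≥ 2 and SR_P ≥ 1 be integers, let SR_O and d be natural numbers with d + 1 ≤ T − 1, and let n = gcd(SR_P, T). If A' ⊆ {0, …, T−1} is any set such that for every a ∈ A' the residue (SR_O + a·SR_P) mod T lies in {d+1, …, T−1}, then A' is a subset of the explicit set { ( (j · (SR_P/n)^{φ(T/n) − 1}) mod (T/n) ) + (T/n)·i : j ∈ D, i ∈ {0, …, n−1} }. In other words, the explicit set of Lemma 1 is maximal among all sets of scheduling-request indices whose associated slots fall in uplink slots. -/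
/-- Euler's theorem for integers: multiplying by `s ^ (φ m - 1)` inverts multiplication by a unit
`s` modulo `m`. -/
theorem Int.mul_mul_pow_totient_pred_modEq {m s : ℤ} (hm : 0 < m) (hs : 0 ≤ s)
    (h : Int.gcd s m = 1) (a : ℤ) :
    a * s * s ^ (Nat.totient m.toNat - 1) ≡ a [ZMOD m] := by
  lift m to ℕ using hm.le
  lift s to ℕ using hs
  have hφ : 0 < Nat.totient m := Nat.totient_pos.2 (by exact_mod_cast hm)
  have key : (s : ℤ) ^ Nat.totient m ≡ 1 [ZMOD m] := by
    exact_mod_cast Int.natCast_modEq_iff.2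
      (Nat.ModEq.pow_totient (x := s) (n := m) (by simpa using h))
  have := key.mul_left a
  rwa [mul_one, ← Nat.sub_add_cancel hφ, pow_succ', ← mul_assoc] at this

/-- Maximality in Lemma 1: any set `A' ⊆ {0, …, T-1}` of scheduling-request indices whose
associated slots `SR_O + a·SR_P` fall (mod `T`) in the uplink slots `{d+1, …, T-1}` is
contained in the explicit set
`{ ((j · (SR_P/n)^{φ(T/n) - 1}) mod (T/n)) + (T/n)·i : j ∈ D, i ∈ {0, …, n-1} }`. -/
theorem stmt1 (T SR_P : ℤ) (SR_O d : ℕ)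
    (hT : 2 ≤ T) (hP : 1 ≤ SR_P) (hd : (d : ℤ) + 1 ≤ T - 1)
    (n : ℤ) (hn : n = Int.gcd SR_P T)
    (A' : Set ℤ) (hA'sub : A' ⊆ {x : ℤ | 0 ≤ x ∧ x ≤ T - 1})
    (hA' : ∀ a ∈ A', (d : ℤ) + 1 ≤ ((SR_O : ℤ) + a * SR_P) % T ∧
        ((SR_O : ℤ) + a * SR_P) % T ≤ T - 1) :
    A' ⊆ {z : ℤ | ∃ j i : ℤ,
        ⌈(((d : ℤ) + 1 - (SR_O : ℤ) : ℤ) : ℚ) / (n : ℚ)⌉ ≤ j ∧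
        j ≤ ⌊(((T : ℤ) - 1 - (SR_O : ℤ) : ℤ) : ℚ) / (n : ℚ)⌋ ∧
        0 ≤ i ∧ i ≤ n - 1 ∧
        z = (j * (SR_P / n) ^ (Nat.totient (T / n).toNat - 1)) % (T / n) + (T / n) * i} := by
  intro a ha
  obtain ⟨h0, h1⟩ := hA'sub ha
  obtain ⟨h2, h3⟩ := hA' a ha
  have hgpos : 0 < Int.gcd SR_P T := Int.gcd_pos_of_ne_zero_left _ (by omega)
  have hnpos : 0 < n := by omega
  obtain ⟨s, hs⟩ : n ∣ SR_P := hn ▸ Int.gcd_dvd_left ..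
  obtain ⟨m, hm⟩ : n ∣ T := hn ▸ Int.gcd_dvd_right ..
  have hsn : SR_P / n = s := by rw [hs, Int.mul_ediv_cancel_left _ hnpos.ne']
  have hmn : T / n = m := by rw [hm, Int.mul_ediv_cancel_left _ hnpos.ne']
  have hm0 : 0 < m := by nlinarith
  have hs0 : 0 ≤ s := by nlinarith
  have hcop : Int.gcd s m = 1 := by
    have := Int.gcd_ediv_gcd_ediv_gcd hgpos
    rwa [← hn, hsn, hmn] at this
  have hnQ : (0 : ℚ) < n := by exact_mod_cast hnpos
  set q := ((SR_O : ℤ) + a * SR_P) / T with hq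
  have hdiv := Int.emod_add_mul_ediv ((SR_O : ℤ) + a * SR_P) T
  rw [← hq] at hdiv
  have hj : (a * s - m * q) * n = ((SR_O : ℤ) + a * SR_P) % T - SR_O := by
    linear_combination -hdiv - a * hs + q * hm
  refine ⟨a * s - m * q, a / m, ?_, ?_, Int.ediv_nonneg h0 hm0.le, ?_, ?_⟩
  · rw [Int.ceil_le, div_le_iff₀ hnQ]
    exact_mod_cast (by linarith : (d : ℤ) + 1 - SR_O ≤ (a * s - m * q) * n)
  · rw [Int.le_floor, le_div_iff₀ hnQ]
    exact_mod_cast (by linarith : (a * s - m * q) * n ≤ T - 1 - SR_O)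
  · exact Int.le_sub_one_of_lt (Int.ediv_lt_of_lt_mul hm0 (by linarith))
  · rw [hsn, hmn]
    have hmod : a * s - m * q ≡ a * s [ZMOD m] := by
      simp [Int.ModEq]
    have := (hmod.mul_right _).trans (Int.mul_mul_pow_totient_pred_modEq hm0 hs0 hcop a)
    rw [this.eq, Int.emod_add_mul_ediv]
end

section
/- Let T ≥ 2 and SR_P ≥ 1 be integers, let SR_O and d be natural numbers with d + 1 ≤ T − 1, and let n = gcd(SR_P, T). Then the cardinality of the set A* = { x ∈ {0, …, T−1} : d + 1 ≤ (SR_O + x·SR_P) mod T ≤ T − 1 } equals n · max(0, ⌊(T − 1 − SR_O)/n⌋ − ⌈(d + 1 − SR_O)/n⌉ + 1), i.e., n times the number of integers j with ⌈(d + 1 − SR_O)/n⌉ ≤ j ≤ ⌊(T − 1 − SR_O)/n⌋. -/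
/-- The number of `x ∈ [0, n * t)` for which `o + x * (n * p)` reduces modulo `n * t` into
`[c, n * t)`, where `p` is invertible modulo `t` with inverse `u`. -/
theorem ncard_affine_emod_ge {n t p u v o c a b : ℤ} (hn : 0 < n) (ht : 0 < t)
    (huv : p * u + t * v = 1) (hc : 0 ≤ c)
    (hD : ∀ j : ℤ, a ≤ j ∧ j ≤ b ↔ c ≤ o + n * j ∧ o + n * j ≤ n * t - 1) :
    ({x : ℤ | 0 ≤ x ∧ x ≤ n * t - 1 ∧ c ≤ (o + x * (n * p)) % (n * t) ∧
        (o + x * (n * p)) % (n * t) ≤ n * t - 1}.ncard : ℤ) = n * max 0 (b - a + 1) := by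
  have hT : 0 < n * t := mul_pos hn ht
  let f : ℤ × ℤ → ℤ := fun z => z.1 * t + (z.2 * u) % t
  have hdiv (z : ℤ × ℤ) : f z / t = z.1 := by
    change (z.1 * t + (z.2 * u) % t) / t = z.1
    rw [Int.add_comm, Int.add_mul_ediv_right _ _ ht.ne', Int.ediv_eq_zero_of_lt
      (Int.emod_nonneg _ ht.ne') (Int.emod_lt_of_pos _ ht), zero_add]
  have hmod (z : ℤ × ℤ) : f z * p ≡ z.2 [ZMOD t] := by
    refine (Int.modEq_iff_dvd.2 ⟨z.2 * v + (z.2 * u / t) * p - z.1 * p, ?_⟩)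
    change z.2 - (z.1 * t + (z.2 * u) % t) * p = _
    have := Int.emod_add_mul_ediv (z.2 * u) t
    linear_combination (-z.2) * huv - p * this
  have hset : {x : ℤ | 0 ≤ x ∧ x ≤ n * t - 1 ∧ c ≤ (o + x * (n * p)) % (n * t) ∧
        (o + x * (n * p)) % (n * t) ≤ n * t - 1} =
      f '' (Finset.Ico 0 n ×ˢ Finset.Icc a b : Finset (ℤ × ℤ)) := by
    ext x
    simp only [Set.mem_ofPred_eq, Set.mem_image, Finset.mem_coe, Finset.mem_product,
      Finset.mem_Ico, Finset.mem_Icc]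
    constructor
    · rintro ⟨hx0, hx1, hr0, hr1⟩
      have hk := Int.emod_add_mul_ediv (o + x * (n * p)) (n * t)
      set k := (o + x * (n * p)) / (n * t)
      have hr : (o + x * (n * p)) % (n * t) = o + n * (x * p - t * k) := by
        linear_combination hk
      rw [hr] at hr0 hr1
      refine ⟨(x / t, x * p - t * k), ⟨⟨Int.ediv_nonneg hx0 ht.le, ?_⟩, (hD _).2 ⟨hr0, hr1⟩⟩, ?_⟩
      · exact Int.ediv_lt_of_lt_mul ht (by linarith)
      · have : (x * p - t * k) * u % t = x % t :=
          Int.modEq_iff_dvd.2 ⟨x * v + k * u, by linear_combination (-x) * huv⟩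
        change x / t * t + (x * p - t * k) * u % t = x
        rw [this, Int.ediv_mul_add_emod]
    · rintro ⟨⟨q, j⟩, ⟨⟨hq0, hq1⟩, hj⟩, rfl⟩
      obtain ⟨h0, h1⟩ := (hD j).1 hj
      have hr : (o + f (q, j) * (n * p)) % (n * t) = o + n * j := by
        have h : n * (f (q, j) * p) ≡ n * j [ZMOD n * t] := (hmod (q, j)).mul_left'
        have h' := (h.add_left o).eq
        rw [Int.emod_eq_of_lt (hc.trans h0) (by linarith)] at h'
        rw [← h']
        congr 1
        ring
      have hm0 := Int.emod_nonneg (j * u) ht.ne'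
      have hm1 := Int.emod_lt_of_pos (j * u) ht
      refine ⟨?_, ?_, hr ▸ h0, hr ▸ h1⟩
      · exact add_nonneg (mul_nonneg hq0 ht.le) hm0
      · change q * t + j * u % t ≤ n * t - 1
        nlinarith
  have hinj : Set.InjOn f (Finset.Ico 0 n ×ˢ Finset.Icc a b : Finset (ℤ × ℤ)) := by
    rintro ⟨q, j⟩ hz ⟨q', j'⟩ hz' h
    simp only [Finset.mem_coe, Finset.mem_product, Finset.mem_Icc] at hz hz'
    obtain ⟨h0, h1⟩ := (hD j).1 hz.2
    obtain ⟨h0', h1'⟩ := (hD j').1 hz'.2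
    have hq : q = q' := by simpa only [hdiv] using congrArg (· / t) h
    have hj : j ≡ j' [ZMOD t] := (hmod (q, j)).symm.trans (h ▸ hmod (q', j'))
    have hnj := ((hj.mul_left' (c := n)).add_left o).eq
    rw [Int.emod_eq_of_lt (hc.trans h0) (by linarith),
      Int.emod_eq_of_lt (hc.trans h0') (by linarith)] at hnj
    exact Prod.ext hq (mul_left_cancel₀ hn.ne' (add_left_cancel hnj))
  rw [hset, hinj.ncard_image, Set.ncard_coe_finset, Finset.card_product,
    Int.card_Ico, Int.card_Icc]
  push_cast
  rw [sub_zero, Int.toNat_of_nonneg hn.le, Int.toNat_eq_max, max_comm]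
  ring_nf

/-- Cardinality of the set `A` of Lemma 1: `|A| = n · |D|`, with
`D = [⌈(d+1-SR_O)/n⌉, ⌊(T-1-SR_O)/n⌋]` and `n = gcd(SR_P, T)`. -/
theorem stmt8 (T SR_P : ℤ) (SR_O d : ℕ)
    (hT : 2 ≤ T) (hP : 1 ≤ SR_P) (hd : (d : ℤ) + 1 ≤ T - 1)
    (n : ℤ) (hn : n = Int.gcd SR_P T) :
    ({x : ℤ | 0 ≤ x ∧ x ≤ T - 1 ∧
        (d : ℤ) + 1 ≤ ((SR_O : ℤ) + x * SR_P) % T ∧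
        ((SR_O : ℤ) + x * SR_P) % T ≤ T - 1}.ncard : ℤ) =
    n * max 0 (⌊(((T : ℤ) - 1 - (SR_O : ℤ)) : ℚ) / (n : ℚ)⌋ -
        ⌈(((d : ℤ) + 1 - (SR_O : ℤ)) : ℚ) / (n : ℚ)⌉ + 1) := by
  have hT0 : 0 < T := by linarith
  have hn0 : 0 < n := by
    rw [hn]
    exact_mod_cast Int.gcd_pos_of_ne_zero_right SR_P hT0.ne'
  obtain ⟨p, hp⟩ : n ∣ SR_P := hn ▸ Int.gcd_dvd_left ..
  obtain ⟨t, ht⟩ : n ∣ T := hn ▸ Int.gcd_dvd_right ..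
  have ht0 : 0 < t := pos_of_mul_pos_right (ht ▸ hT0) hn0.le
  have huv : p * Int.gcdA SR_P T + t * Int.gcdB SR_P T = 1 := by
    have h := Int.gcd_eq_gcd_ab SR_P T
    rw [← hn] at h
    apply mul_left_cancel₀ hn0.ne'
    linear_combination -h - Int.gcdA SR_P T * hp - Int.gcdB SR_P T * ht
  have hnQ : (0 : ℚ) < n := by exact_mod_cast hn0
  have key := ncard_affine_emod_ge (o := SR_O) (c := d + 1)
    (a := ⌈(((d : ℤ) + 1 - (SR_O : ℤ)) : ℚ) / (n : ℚ)⌉)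
    (b := ⌊(((T : ℤ) - 1 - (SR_O : ℤ)) : ℚ) / (n : ℚ)⌋) hn0 ht0 huv (by positivity) (by
      intro j
      rw [Int.ceil_le, Int.le_floor, div_le_iff₀ hnQ, le_div_iff₀ hnQ, ← ht,
        ← Int.cast_le (R := ℚ) (m := (d : ℤ) + 1), ← Int.cast_le (R := ℚ) (n := T - 1)]
      push_cast
      constructor <;> rintro ⟨h₁, h₂⟩ <;> constructor <;> linarith)
  rwa [← hp, ← ht] at key
end

section
/- Let T ≥ 1 and SR_P ≥ 1 be integers, and let k'_0 < k'_1 < … < k'_{T'−1} be a nonempty strictly increasing finite sequence of integers in {1, …, T}. Define M = { (k'_j + q·T) · SR_P : j ∈ {0, …, T'−1}, q ∈ ℕ }. Let R ≥ 0 be an integer, and set q = ⌊R / (T·SR_P)⌋ and r = R mod (T·SR_P). Assume r is not equal to k'_j·SR_P for any j. Then the least element of M that is strictly greater than R equals: (k'_0 + q·T)·SR_P if r < k'_0·SR_P; (k'_0 + (q+1)·T)·SR_P if r > k'_{T'−1}·SR_P; and (k'_{i+1} + q·T)·SR_P if k'_i·SR_P < r < k'_{i+1}·SR_P for some i ∈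 {0, …, T'−2}. -/
/-- A time `(a + n * T) * P` with `a ≤ T` that lies strictly after `R` belongs either to the
period of `R`, with an offset exceeding the remainder of `R`, or to a later period. -/
theorem eq_ediv_or_succ_le_of_lt_period_mul {T P R a n : ℤ} (hT : 1 ≤ T) (hP : 1 ≤ P) (ha : a ≤ T)
    (h : R < (a + n * T) * P) :
    (n = R / (T * P) ∧ R % (T * P) < a * P) ∨ R / (T * P) + 1 ≤ n := by
  have hTP : 0 < T * P := by positivity
  have hdiv := Int.emod_add_mul_ediv R (T * P)
  have hr := Int.emod_nonneg R hTP.ne'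
  rcases lt_trichotomy n (R / (T * P)) with hn | rfl | hn
  · have h1 : (T * P) * (n + 1) ≤ (T * P) * (R / (T * P)) := by gcongr; omega
    have h2 : a * P ≤ T * P := by gcongr
    nlinarith
  · exact Or.inl ⟨rfl, by linarith⟩
  · exact Or.inr hn

/-- Case analysis of Eq. 7 of the paper (the waiting time `w₁`): given the sorted
scheduling-request slots `k'_0 < … < k'_{T'-1}` in `{1, …, T}`, the set
`M = {(k'_j + q·T)·SR_P : j, q ∈ ℕ}` of scheduling-request times, a ready time `R ≥ 0`
with `q = ⌊R/(T·SR_P)⌋`, `r = R mod (T·SR_P)`, and `r ≠ k'_j·SR_P` for all `j`, the least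
element of `M` strictly greater than `R` is given by the three-way case analysis. -/
theorem stmt9 (T SR_P : ℤ) (hT : 1 ≤ T) (hP : 1 ≤ SR_P)
    (T' : ℕ) (hT' : 0 < T')
    (k : Fin T' → ℤ) (hmono : StrictMono k)
    (hrange : ∀ j, 1 ≤ k j ∧ k j ≤ T)
    (M : Set ℤ)
    (hM : M = {m : ℤ | ∃ (j : Fin T') (q : ℕ), m = (k j + (q : ℤ) * T) * SR_P})
    (R : ℤ) (hR : 0 ≤ R)
    (q r : ℤ) (hq : q = R / (T * SR_P)) (hr : r = R % (T * SR_P))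
    (hne : ∀ j : Fin T', r ≠ k j * SR_P) :
    (r < k ⟨0, hT'⟩ * SR_P →
      IsLeast {m ∈ M | R < m} ((k ⟨0, hT'⟩ + q * T) * SR_P)) ∧
    (k ⟨T' - 1, Nat.sub_lt hT' one_pos⟩ * SR_P < r →
      IsLeast {m ∈ M | R < m} ((k ⟨0, hT'⟩ + (q + 1) * T) * SR_P)) ∧
    (∀ (i : ℕ) (hi : i + 1 < T'),
      k ⟨i, Nat.lt_of_succ_lt hi⟩ * SR_P < r → r < k ⟨i + 1, hi⟩ * SR_P →
      IsLeast {m ∈ M | R < m} ((k ⟨i + 1, hi⟩ + q * T) * SR_P)) := by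
  have hTP : 0 < T * SR_P := by positivity
  have hP0 : 0 < SR_P := by omega
  have hdiv : r + T * SR_P * q = R := by rw [hq, hr]; exact Int.emod_add_mul_ediv R _
  have hrlt : r < T * SR_P := hr ▸ Int.emod_lt_of_pos R hTP
  have hq0 : 0 ≤ q := hq ▸ Int.ediv_nonneg hR hTP.le
  have hcases (j : Fin T') (n : ℕ) (h : R < (k j + n * T) * SR_P) :
      ((n : ℤ) = q ∧ r < k j * SR_P) ∨ q + 1 ≤ (n : ℤ) := by
    rw [hq, hr]
    exact eq_ediv_or_succ_le_of_lt_period_mul hT hP (hrange j).2 h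
  have hfirst (j : Fin T') : k ⟨0, hT'⟩ ≤ k j := hmono.monotone (Nat.zero_le j.1)
  have hlater (n : ℤ) (hn : q + 1 ≤ n) : (q + 1) * T ≤ n * T := by gcongr
  have hcurrent (i : Fin T') (hi : r < k i * SR_P)
      (hmin : ∀ j, r < k j * SR_P → k i ≤ k j) :
      IsLeast {m ∈ M | R < m} ((k i + q * T) * SR_P) := by
    subst hM
    refine ⟨⟨⟨i, q.toNat, by rw [Int.toNat_of_nonneg hq0]⟩, by linarith⟩, ?_⟩
    rintro _ ⟨⟨j, n, rfl⟩, h⟩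
    refine mul_le_mul_of_nonneg_right ?_ hP0.le
    rcases hcases j n h with ⟨hn, hj⟩ | hn
    · rw [hn]
      linarith [hmin j hj]
    · linarith [hlater n hn, (hrange i).2, (hrange j).1]
  refine ⟨fun h => hcurrent _ h fun j _ => hfirst j, fun h => ?_, fun i hi h1 h2 => ?_⟩
  · subst hM
    refine ⟨⟨⟨⟨0, hT'⟩, (q + 1).toNat, by rw [Int.toNat_of_nonneg (by omega)]⟩, ?_⟩, ?_⟩
    · have := mul_pos (show 0 < k ⟨0, hT'⟩ by linarith [(hrange ⟨0, hT'⟩).1]) hP0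
      linarith
    · rintro _ ⟨⟨j, n, rfl⟩, hm⟩
      refine mul_le_mul_of_nonneg_right ?_ hP0.le
      rcases hcases j n hm with ⟨-, hj⟩ | hn
      · have hlast : j ≤ ⟨T' - 1, Nat.sub_lt hT' one_pos⟩ := Nat.le_sub_one_of_lt j.2
        have := mul_le_mul_of_nonneg_right (hmono.monotone hlast) hP0.le
        linarith
      · linarith [hlater n hn, hfirst j]
  · refine hcurrent _ h2 fun j hj => hmono.monotone ?_
    have hlt := hmono.lt_iff_lt.mp (lt_of_mul_lt_mul_right (h1.trans hj) hP0.le)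
    exact Nat.succ_le_of_lt hlt
end
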